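/- arXiv:1710.04115 — 2 statements merged into one kernel-verified Lean document; each statement's English description precedes it below -/
import Mathlib

section
/- There exists a GFG Büchi automaton A = (Σ, Q, Q₀, δ, α) such that L(A) is recognized by some deterministic co-Büchi automaton (hence by a GFG co-Büchi automaton), yet there is no co-Büchi condition α' ⊆ Q for which the automaton (Σ, Q, Q₀, δ, α') is equivalent to A. In particular, the weak tightness hypothesis cannot be omitted from the co-Büchi-typeness of GFG Streett (even Büchi) automata. -/
namespace GFG

/-- The structure of a nondeterministic automaton on infinite words:
alphabet `A`, states `Q`, initial states and transition function.
The acceptance condition is kept separate, as a predicate on the set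
of states visited infinitely often. -/
structure Auto (A Q : Type) where
  init : Set Q
  next : Q → A → Set Q

variable {A Q Mem : Type}

/-- `r` is a run of the automaton `M` on the infinite word `w`. -/
def Auto.IsRun (M : Auto A Q) (w : ℕ → A) (r : ℕ → Q) : Prop :=
  r 0 ∈ M.init ∧ ∀ i, r (i + 1) ∈ M.next (r i) (w i)

/-- The set of states occurring infinitely often in `r`. -/
def InfOcc (r : ℕ → Q) : Set Q := {q | ∀ n, ∃ m, n ≤ m ∧ r m = q}

/-- The language of `M` with acceptance condition `acc` (a predicate on `inf(r)`). -/
def Auto.Lang (M : Auto A Q) (acc : Set Q → Prop) : Set (ℕ → A) :=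
  {w | ∃ r, M.IsRun w r ∧ acc (InfOcc r)}

/-- `M` is deterministic: one initial state and at most one successor per state/letter. -/
def Auto.IsDet (M : Auto A Q) : Prop :=
  (∃ q0, M.init = {q0}) ∧ ∀ q a, (M.next q a).Subsingleton

/-- `A^q`: the automaton `M` with set of initial states `{q}`. -/
def Auto.withInit (M : Auto A Q) (q : Q) : Auto A Q := ⟨{q}, M.next⟩

/-- Büchi condition: `inf(r) ∩ α ≠ ∅`. -/
def BuchiAcc (α : Set Q) (S : Set Q) : Prop := (S ∩ α).Nonempty

/-- co-Büchi condition: `inf(r) ∩ α = ∅`. -/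
def CoBuchiAcc (α : Set Q) (S : Set Q) : Prop := S ∩ α = ∅

/-- Rabin condition with bad sets `E i` and good sets `F i`. -/
def RabinAcc {ι : Type} (E F : ι → Set Q) (S : Set Q) : Prop :=
  ∃ i, S ∩ E i = ∅ ∧ (S ∩ F i).Nonempty

/-- Streett condition with pairs `(E i, F i)`. -/
def StreettAcc {ι : Type} (E F : ι → Set Q) (S : Set Q) : Prop :=
  ∀ i, S ∩ E i = ∅ ∨ (S ∩ F i).Nonempty

/-- Parity condition: the minimal priority seen infinitely often is even. -/
def ParityAcc (c : Q → ℕ) (S : Set Q) : Prop := Even (sInf (c '' S))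

/-- The prefix of length `n` of the infinite word `w`, as a list. -/
def prefixWord (w : ℕ → A) (n : ℕ) : List A := (List.range n).map w

/-- The run induced by a strategy `g : A* → Q` on the word `w`:
`g(ε), g(a₁), g(a₁a₂), …`. -/
def StrategyRun (g : List A → Q) (w : ℕ → A) : ℕ → Q := fun n => g (prefixWord w n)

/-- `g` witnesses GFGness of `M` (with acceptance `acc`): for every word `w` the
induced sequence is a run of `M` on `w`, accepting whenever `w ∈ L(M)`. -/
def IsGFGStrategy (M : Auto A Q) (acc : Set Q → Prop) (g : List A → Q) : Prop :=
  ∀ w : ℕ → A, M.IsRun w (StrategyRun g w) ∧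
    (w ∈ M.Lang acc → acc (InfOcc (StrategyRun g w)))

/-- `M` is good for games. -/
def IsGFG (M : Auto A Q) (acc : Set Q → Prop) : Prop :=
  ∃ g : List A → Q, IsGFGStrategy M acc g

/-- `M` is unambiguous: every word of the language has exactly one accepting run. -/
def Unambiguous (M : Auto A Q) (acc : Set Q → Prop) : Prop :=
  ∀ w ∈ M.Lang acc, ∃! r : ℕ → Q, M.IsRun w r ∧ acc (InfOcc r)

/-- `M` is determinizable by pruning. -/
def DetByP (M : Auto A Q) (acc : Set Q → Prop) : Prop :=
  ∃ q0 ∈ M.init, ∃ next' : Q → A → Set Q,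
    (∀ q a, next' q a ⊆ M.next q a ∧ (next' q a).Subsingleton) ∧
    (⟨{q0}, next'⟩ : Auto A Q).Lang acc = M.Lang acc

/-- A finite-state strategy (transducer): memories `Mem`, initial memory `m0`,
memory update function `upd` and output function `out`. -/
structure Transducer (A Q Mem : Type) where
  m0 : Mem
  upd : Mem → A → Mem
  out : Mem → Q

namespace Transducer

variable (T : Transducer A Q Mem)

/-- The memory reached from `m` after reading the finite word `u`. -/
def run (m : Mem) (u : List A) : Mem := u.foldl T.upd m

/-- The strategy generated by the transducer: `u ↦ τ(ρ(m₀, u))`. -/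
def strategy : List A → Q := fun u => T.out (T.run T.m0 u)

/-- The deterministic automaton `A_g`, with initial memory replaced by `m`. -/
def autoFrom (m : Mem) : Auto A Mem := ⟨{m}, fun m' a => {T.upd m' a}⟩

/-- The deterministic automaton `A_g` itself. -/
def auto : Auto A Mem := T.autoFrom T.m0

/-- The acceptance condition `α_g` of `A_g`, obtained from `acc` by replacing each
set `F ⊆ Q` appearing in it by `{m | τ(m) ∈ F}`. -/
def accG (acc : Set Q → Prop) : Set Mem → Prop := fun S => acc (T.out '' S)

/-- `m` is reachable in `A_g` from the initial memory. -/
def Reachable (m : Mem) : Prop := ∃ u : List A, T.run T.m0 u = m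

/-- The set of memories visited along the path of `A_g` that starts at `m` and
reads the finite word `u` (both endpoints included). -/
def pathStates (m : Mem) (u : List A) : Set Mem :=
  {m' | ∃ v : List A, v <+: u ∧ T.run m v = m'}

/-- `P_{src → dst}`: the (words inducing the) finite paths of `A_g` from `src` to `dst`. -/
def PathSet (src dst : Mem) : Set (List A) :=
  {u : List A | u ≠ [] ∧ T.run src u = dst}

/-- Every combination of paths from `P_{src → dst}` satisfies `α_g`. -/
def AllCombosAcc (acc : Set Q → Prop) (src dst : Mem) : Prop :=
  ∀ S : Set (List A), S.Nonempty → S ⊆ T.PathSet src dst →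
    T.accG acc (⋃ u ∈ S, T.pathStates src u)

/-- `P_{src → dst}` is empty, or every combination of its paths satisfies `α_g`. -/
def GoodPathSet (acc : Set Q → Prop) (src dst : Mem) : Prop :=
  T.PathSet src dst = ∅ ∨ T.AllCombosAcc acc src dst

/-- `m` is replaceable by `m'`: the set `P_{m' → m}` of paths of `A_g` from `m'`
to `m` is empty, or every combination of its paths satisfies `α_g`. -/
def Replaceable (acc : Set Q → Prop) (m m' : Mem) : Prop :=
  T.GoodPathSet acc m' m

/-- The transition `(q, a, q')` is used by the strategy. -/
def Uses (q : Q) (a : A) (q' : Q) : Prop :=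
  ∃ u : List A, T.strategy u = q ∧ T.strategy (u ++ [a]) = q'

/-- The nonempty word `u` induces a cycle of `A_g` through the memory `m`. -/
def CycleThrough (m : Mem) (u : List A) : Prop := u ≠ [] ∧ T.run m u = m

/-- The cycle of `A_g` through `m` induced by `u` is accepting. -/
def AccCycle (acc : Set Q → Prop) (m : Mem) (u : List A) : Prop :=
  T.CycleThrough m u ∧ T.accG acc (T.pathStates m u)

/-- The cycle of `A_g` through `m` induced by `u` is rejecting. -/
def RejCycle (acc : Set Q → Prop) (m : Mem) (u : List A) : Prop :=
  T.CycleThrough m u ∧ ¬ T.accG acc (T.pathStates m u)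

/-- The cycle of `A_g` through `m` induced by `u` is `q`-exclusive accepting:
it is accepting, but its set of memories minus the memories of `q` is not. -/
def ExclAccCycle (acc : Set Q → Prop) (q : Q) (m : Mem) (u : List A) : Prop :=
  T.CycleThrough m u ∧ T.accG acc (T.pathStates m u) ∧
    ¬ T.accG acc (T.pathStates m u \ {m' : Mem | T.out m' = q})

end Transducer

/-- `M` is weakly tight with respect to `T`: every transition of `M` is used. -/
def WeaklyTightWrt (M : Auto A Q) (T : Transducer A Q Mem) : Prop :=
  ∀ q a q', q' ∈ M.next q a → T.Uses q a q'

/-- `M` is tight with respect to `T`: every transition of `M` is used, and no memory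
is replaceable by a different memory of the same state. -/
def TightWrt (M : Auto A Q) (acc : Set Q → Prop) (T : Transducer A Q Mem) : Prop :=
  WeaklyTightWrt M T ∧
  ∀ m m' : Mem, m ≠ m' → T.out m = T.out m' → ¬ T.Replaceable acc m m'

/-- `M` is tight: tight with respect to some finite-state strategy witnessing its GFGness. -/
def Tight (M : Auto A Q) (acc : Set Q → Prop) : Prop :=
  ∃ (Mem : Type) (_ : Fintype Mem) (T : Transducer A Q Mem),
    IsGFGStrategy M acc T.strategy ∧ TightWrt M acc T

/-- `M` is weakly tight: weakly tight with respect to some finite-state strategy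
witnessing its GFGness. -/
def WeaklyTight (M : Auto A Q) (acc : Set Q → Prop) : Prop :=
  ∃ (Mem : Type) (_ : Fintype Mem) (T : Transducer A Q Mem),
    IsGFGStrategy M acc T.strategy ∧ WeaklyTightWrt M T

/-- A Rabin automaton `M` (with pairs `(E i, F i)`) is strongly tight with respect to `T`:
tight, and every state appearing in some good set has a `q`-exclusive accepting cycle
in `A_g`. -/
def StronglyTightWrt {ι : Type} (M : Auto A Q) (E F : ι → Set Q)
    (T : Transducer A Q Mem) : Prop :=
  TightWrt M (RabinAcc E F) T ∧
  ∀ q : Q, (∃ i, q ∈ F i) →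
    ∃ (m : Mem) (u : List A), T.ExclAccCycle (RabinAcc E F) q m u

/-- A Rabin automaton is strongly tight: strongly tight with respect to some finite-state
strategy witnessing its GFGness. -/
def StronglyTight {ι : Type} (M : Auto A Q) (E F : ι → Set Q) : Prop :=
  ∃ (Mem : Type) (_ : Fintype Mem) (T : Transducer A Q Mem),
    IsGFGStrategy M (RabinAcc E F) T.strategy ∧ StronglyTightWrt M E F T

/-- One-step reachability in the transition graph of `M`. -/
def Auto.Step (M : Auto A Q) (q q' : Q) : Prop := ∃ a, q' ∈ M.next q a

/-- Reachability in the transition graph of `M`. -/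
def Auto.Reach (M : Auto A Q) : Q → Q → Prop := Relation.ReflTransGen M.Step

/-- The Büchi automaton `(M, α)` is weak: each strongly connected component is either
contained in `α` or disjoint from `α`. -/
def Auto.IsWeak (M : Auto A Q) (α : Set Q) : Prop :=
  ∀ q q', M.Reach q q' → M.Reach q' q → (q ∈ α ↔ q' ∈ α)

/-- deterministic step: `0,1` alternate on `true`; `false` leads to `2`; then `true` to `3`. -/
def exD : Fin 4 → Bool → Fin 4
  | 0, true => 1
  | 1, true => 0
  | 2, true => 3
  | 3, true => 3
  | 0, false => 2
  | 1, false => 2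
  | 2, false => 2
  | 3, false => 3

def exDA : Auto Bool (Fin 4) := ⟨{0}, fun q a => {exD q a}⟩

def exM : Auto Bool (Fin 4) :=
  ⟨{0}, fun q a => {q' | q' = exD q a ∨ (q = 0 ∧ a = false ∧ q' = 0)}⟩

def exP (w : ℕ → Bool) : Prop :=
  (∀ i, w i = true) ∨ ∃ i j, i < j ∧ w i = false ∧ w j = true

theorem exM_of_exD {w r} (h : exDA.IsRun w r) : exM.IsRun w r :=
  ⟨h.1, fun i => Or.inl (h.2 i)⟩

theorem exM_inv {w r} (h : exM.IsRun w r) (n : ℕ) :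
    ((r n = 2 ∨ r n = 3) → ∃ i, i < n ∧ w i = false) ∧
    (r n = 3 → ∃ i j, i < j ∧ w i = false ∧ w j = true) := by
  induction n with
  | zero =>
    have h0 : r 0 = 0 := h.1
    simp [h0]
  | succ n ih =>
    have hn : r (n+1) = exD (r n) (w n) ∨ (r n = 0 ∧ w n = false ∧ r (n+1) = 0) := h.2 n
    rcases hn with hn | ⟨_, _, hn⟩
    · rw [hn]
      have key : ∀ q a, ((exD q a = 2 ∨ exD q a = 3) → (q = 2 ∨ q = 3) ∨ a = false) ∧
        (exD q a = 3 → q = 3 ∨ (q = 2 ∧ a = true)) := by decide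
      obtain ⟨k1, k2⟩ := key (r n) (w n)
      refine ⟨fun hh => ?_, fun hh => ?_⟩
      · rcases k1 hh with h1 | h1
        · obtain ⟨i, hi, hw⟩ := ih.1 h1
          exact ⟨i, by omega, hw⟩
        · exact ⟨n, by omega, h1⟩
      · rcases k2 hh with h1 | ⟨h1, h2⟩
        · exact ih.2 h1
        · obtain ⟨i, hi, hw⟩ := ih.1 (Or.inl h1)
          exact ⟨i, n, hi, hw, h2⟩
    · simp [hn]

theorem exM_buchi {w} (h : w ∈ exM.Lang (BuchiAcc {1, 3})) : exP w := by
  obtain ⟨r, hr, q, hq, hq'⟩ := h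
  rcases hq' with rfl | rfl
  · by_contra hP
    unfold exP at hP
    push Not at hP
    obtain ⟨⟨i, hi⟩, hP⟩ := hP
    obtain ⟨m, hm, hm1⟩ := hq (i + 2)
    obtain ⟨k, rfl⟩ : ∃ k, m = k + 1 := ⟨m - 1, by omega⟩
    have hn : r (k+1) = exD (r k) (w k) ∨ (r k = 0 ∧ w k = false ∧ r (k+1) = 0) := hr.2 k
    rw [hm1] at hn
    have key : ∀ q a, 1 = exD q a → a = true := by decide
    rcases hn with hn | ⟨_, _, hn⟩
    · exact hP i k (by omega) (by simpa using hi) (key _ _ hn)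
    · simp at hn
  · obtain ⟨m, -, hm⟩ := hq 0
    exact Or.inr ((exM_inv hr m).2 hm)

theorem exD_inv {w r} (h : exDA.IsRun w r) (n : ℕ) :
    ((r n = 0 ∨ r n = 1) → ∀ i, i < n → w i = true) ∧
    ((∃ i j, i < j ∧ j < n ∧ w i = false ∧ w j = true) → r n = 3) := by
  induction n with
  | zero => simp
  | succ n ih =>
    have hn : r (n+1) = exD (r n) (w n) := h.2 n
    have key : ∀ q a, ((exD q a = 0 ∨ exD q a = 1) → (q = 0 ∨ q = 1) ∧ a = true) ∧
        (q = 3 → exD q a = 3) ∧ (¬ (q = 0 ∨ q = 1) → a = true → exD q a = 3) := by decide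
    rw [hn]
    obtain ⟨k1, k2, k3⟩ := key (r n) (w n)
    refine ⟨fun hh i hi => ?_, ?_⟩
    · rcases Nat.lt_succ_iff_lt_or_eq.1 hi with h1 | rfl
      · exact ih.1 (k1 hh).1 i h1
      · exact (k1 hh).2
    · rintro ⟨i, j, hij, hj, hi, hj'⟩
      rcases Nat.lt_succ_iff_lt_or_eq.1 hj with h1 | rfl
      · exact k2 (ih.2 ⟨i, j, hij, h1, hi, hj'⟩)
      · refine k3 (fun hh => ?_) hj'
        have := ih.1 hh i hij
        simp [hi] at this

theorem exM_all {w r} (hw : ∀ i, w i = true) (h : exM.IsRun w r) (n : ℕ) :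
    (r n = 0 ∧ r (n+1) = 1) ∨ (r n = 1 ∧ r (n+1) = 0) := by
  have hn : ∀ n, r (n+1) = exD (r n) true := by
    intro n
    rcases h.2 n with h1 | ⟨_, h1, _⟩
    · rw [hw n] at h1
      exact h1
    · simp [hw n] at h1
  induction n with
  | zero =>
    have h0 : r 0 = 0 := h.1
    left
    exact ⟨h0, by rw [hn, h0]; rfl⟩
  | succ n ih =>
    rcases ih with ⟨_, h1⟩ | ⟨_, h1⟩
    · right; exact ⟨h1, by rw [hn, h1]; rfl⟩
    · left; exact ⟨h1, by rw [hn, h1]; rfl⟩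

theorem exD_acc {w r} (h : exDA.IsRun w r) (hP : exP w) :
    BuchiAcc {1, 3} (InfOcc r) ∧ CoBuchiAcc {2} (InfOcc r) := by
  rcases hP with hw | ⟨i, j, hij, hi, hj⟩
  · have ha := exM_all hw (exM_of_exD h)
    constructor
    · refine ⟨1, fun n => ?_, by simp⟩
      rcases ha n with h1 | h1
      · exact ⟨n+1, by omega, h1.2⟩
      · exact ⟨n, by omega, h1.1⟩
    · apply Set.eq_empty_of_forall_notMem
      rintro q ⟨hq, rfl⟩
      obtain ⟨m, -, hm⟩ := hq 0
      rcases ha m with h1 | h1 <;> simp [hm] at h1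
  · have h3 : ∀ n, j < n → r n = 3 := fun n hn => (exD_inv h n).2 ⟨i, j, hij, hn, hi, hj⟩
    constructor
    · exact ⟨3, fun n => ⟨n + j + 1, by omega, h3 _ (by omega)⟩, by simp⟩
    · apply Set.eq_empty_of_forall_notMem
      rintro q ⟨hq, rfl⟩
      obtain ⟨m, hm, hm'⟩ := hq (j+1)
      simp [h3 m (by omega)] at hm'

theorem exD_cobuchi {w} (h : w ∈ exDA.Lang (CoBuchiAcc {2})) : exP w := by
  obtain ⟨r, hr, hacc⟩ := h
  have h2 : (2 : Fin 4) ∉ InfOcc r := fun h => by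
    have : (2 : Fin 4) ∈ InfOcc r ∩ {2} := ⟨h, rfl⟩
    rw [hacc] at this
    exact this
  simp only [InfOcc, Set.mem_setOf_eq, not_forall, not_exists, not_and] at h2
  obtain ⟨N, hN⟩ := h2
  by_cases h3 : ∃ m, r m = 3
  · obtain ⟨m, hm⟩ := h3
    exact Or.inr ((exM_inv (exM_of_exD hr) m).2 hm)
  · left
    intro i
    have key : ∀ q : Fin 4, q ≠ 2 → q ≠ 3 → (q = 0 ∨ q = 1) := by decide
    exact (exD_inv hr (N + i + 1)).1
      (key _ (hN _ (by omega)) (fun hh => h3 ⟨_, hh⟩)) i (by omega)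

def exG (u : List Bool) : Fin 4 := u.foldl exD 0

theorem exG_run (w : ℕ → Bool) : exDA.IsRun w (StrategyRun exG w) := by
  refine ⟨rfl, fun i => ?_⟩
  show exG (prefixWord w (i+1)) = exD (exG (prefixWord w i)) (w i)
  simp [exG, prefixWord, List.range_succ]

theorem exM_lang : exM.Lang (BuchiAcc {1, 3}) = {w | exP w} := by
  ext w
  exact ⟨exM_buchi, fun h => ⟨_, exM_of_exD (exG_run w), (exD_acc (exG_run w) h).1⟩⟩

theorem exD_lang : exDA.Lang (CoBuchiAcc {2}) = {w | exP w} := by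
  ext w
  exact ⟨exD_cobuchi, fun h => ⟨_, exG_run w, (exD_acc (exG_run w) h).2⟩⟩

/-- There is a GFG Büchi automaton whose language is recognized by a
deterministic co-Büchi automaton, yet no co-Büchi condition on the same structure
yields an equivalent automaton. -/
theorem stmt8 :
    ∃ (A Q : Type) (_ : Fintype A) (_ : Fintype Q)
      (M : Auto A Q) (α : Set Q),
      IsGFG M (BuchiAcc α) ∧
      (∃ (Q' : Type) (_ : Fintype Q') (D : Auto A Q') (β : Set Q'),
        D.IsDet ∧ D.Lang (CoBuchiAcc β) = M.Lang (BuchiAcc α)) ∧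
      ¬ ∃ α' : Set Q, M.Lang (CoBuchiAcc α') = M.Lang (BuchiAcc α) := by
  refine ⟨Bool, Fin 4, inferInstance, inferInstance, exM, {1, 3}, ?_, ?_, ?_⟩
  · exact ⟨exG, fun w => ⟨exM_of_exD (exG_run w),
      fun h => (exD_acc (exG_run w) (exM_buchi h)).1⟩⟩
  · exact ⟨Fin 4, inferInstance, exDA, {2},
      ⟨⟨0, rfl⟩, fun q a => Set.subsingleton_singleton⟩, exD_lang.trans exM_lang.symm⟩
  · rintro ⟨α', hα⟩
    rw [exM_lang] at hα
    have h1 : (fun _ => true) ∈ exM.Lang (CoBuchiAcc α') := by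
      rw [hα]; exact Or.inl fun _ => rfl
    obtain ⟨r, hr, hacc⟩ := h1
    have ha := exM_all (fun _ => rfl) hr
    have h0 : (0 : Fin 4) ∈ InfOcc r := by
      intro n
      rcases ha n with h1 | h1
      · exact ⟨n, by omega, h1.1⟩
      · exact ⟨n+1, by omega, h1.2⟩
    have h0' : (0 : Fin 4) ∉ α' := fun h => by
      have : (0 : Fin 4) ∈ InfOcc r ∩ α' := ⟨h0, h⟩
      rw [hacc] at this
      exact this
    have h2 : (fun _ => false) ∈ exM.Lang (CoBuchiAcc α') := by
      refine ⟨fun _ => 0, ⟨rfl, fun i => Or.inr ⟨rfl, rfl, rfl⟩⟩, ?_⟩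
      apply Set.eq_empty_of_forall_notMem
      rintro q ⟨hq, hq'⟩
      obtain ⟨m, -, hm⟩ := hq 0
      subst hm
      exact h0' hq'
    rw [hα] at h2
    rcases h2 with h2 | ⟨i, j, _, _, h2⟩
    · simpa using h2 0
    · simp at h2

end GFG
end

section
/- Tight GFG Rabin automata are Büchi-type: if A = (Σ, Q, Q₀, δ, α) is a tight GFG Rabin automaton such that L(A) is recognized by some GFG Büchi automaton, then there exists a Büchi condition α' ⊆ Q such that the Büchi automaton A' = (Σ, Q, Q₀, δ, α') is GFG and equivalent to A. -/
namespace GFG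

variable {A Q Mem : Type}

theorem rabin_union {ι : Type} {E F : ι → Set Q} {S T : Set Q}
    (h : RabinAcc E F (S ∪ T)) : RabinAcc E F S ∨ RabinAcc E F T := by
  obtain ⟨i, h1, x, hx, hF⟩ := h
  rw [Set.union_inter_distrib_right, Set.union_empty_iff] at h1
  rcases hx with hx | hx
  · exact Or.inl ⟨i, h1.1, x, hx, hF⟩
  · exact Or.inr ⟨i, h1.2, x, hx, hF⟩

theorem rabin_iUnion {ι κ : Type} {E F : ι → Set Q} {S : κ → Set Q} {t : Set κ}
    (h : RabinAcc E F (⋃ k ∈ t, S k)) : ∃ k ∈ t, RabinAcc E F (S k) := by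
  obtain ⟨i, h1, x, hx, hF⟩ := h
  simp only [Set.mem_iUnion] at hx
  obtain ⟨k, hk, hx⟩ := hx
  refine ⟨k, hk, i, ?_, x, hx, hF⟩
  rw [← Set.subset_empty_iff, ← h1]
  exact Set.inter_subset_inter_left _ (Set.subset_biUnion_of_mem (u := S) hk)

theorem length_prefixWord (w : ℕ → A) (n : ℕ) : (prefixWord w n).length = n := by
  simp [prefixWord]

theorem prefixWord_succ (w : ℕ → A) (n : ℕ) :
    prefixWord w (n + 1) = prefixWord w n ++ [w n] := by
  simp [prefixWord, List.range_succ]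

theorem prefixWord_mono (w : ℕ → A) {a b : ℕ} (h : a ≤ b) :
    prefixWord w a <+: prefixWord w b := by
  induction h with
  | refl => exact List.prefix_rfl
  | step _ ih => rw [prefixWord_succ]; exact ih.trans (List.prefix_append _ _)

theorem eq_prefixWord (w : ℕ → A) {n : ℕ} {p : List A} (h : p <+: prefixWord w n) :
    p = prefixWord w p.length := by
  have hl : p.length ≤ n := by simpa [length_prefixWord] using h.length_le
  have := List.prefix_of_prefix_length_le h (prefixWord_mono w hl)
    (by simp [length_prefixWord])
  exact this.eq_of_length (by simp [length_prefixWord])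

theorem exists_inf [Finite Q] (r : ℕ → Q) (P : Q → Prop)
    (h : ∀ n, ∃ m, n ≤ m ∧ P (r m)) : ∃ q ∈ InfOcc r, P q := by
  by_contra hc
  push Not at hc
  have : ∀ q, ∃ n, P q → ∀ m, n ≤ m → r m ≠ q := by
    intro q
    by_cases hq : P q
    · have := mt (hc q) (not_not.mpr hq)
      simp only [InfOcc, Set.mem_ofPred_eq] at this
      push Not at this
      obtain ⟨n, hn⟩ := this
      exact ⟨n, fun _ => hn⟩
    · exact ⟨0, fun h => absurd h hq⟩
  choose f hf using this
  obtain ⟨N, hN⟩ := (Set.finite_range f).bddAbove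
  obtain ⟨m, hm, hP⟩ := h N
  exact hf _ hP m ((hN ⟨r m, rfl⟩).trans hm) rfl

theorem eventually_inf [Finite Q] (r : ℕ → Q) : ∃ N, ∀ n, N ≤ n → r n ∈ InfOcc r := by
  by_contra hc
  push Not at hc
  obtain ⟨q, hq, hq'⟩ := exists_inf r (fun q => q ∉ InfOcc r) hc
  exact hq' hq

theorem inf_image [Finite Mem] (f : Mem → Q) (r : ℕ → Mem) :
    InfOcc (fun n => f (r n)) = f '' InfOcc r := by
  ext q
  constructor
  · intro h
    obtain ⟨m, hm, hq⟩ := exists_inf r (fun m => f m = q) h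
    exact ⟨m, hm, hq⟩
  · rintro ⟨m, hm, rfl⟩ n
    obtain ⟨k, hk, rfl⟩ := hm n
    exact ⟨k, hk, rfl⟩

/-- from any time on, a window covers the whole infinity set and returns to a given state -/
theorem exists_window [Finite Q] (r : ℕ → Q) {q : Q} (hq : q ∈ InfOcc r) :
    ∃ N k, 0 < k ∧ r N = q ∧ r (N + k) = q ∧
      {x | ∃ j, j ≤ k ∧ r (N + j) = x} = InfOcc r := by
  obtain ⟨N0, hN0⟩ := eventually_inf r
  obtain ⟨N, hN, hNq⟩ := hq N0
  have : ∀ x, ∃ n, x ∈ InfOcc r → N ≤ n ∧ r n = x := by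
    intro x
    by_cases hx : x ∈ InfOcc r
    · obtain ⟨n, h⟩ := hx N
      exact ⟨n, fun _ => h⟩
    · exact ⟨0, fun h => absurd h hx⟩
  choose f hf using this
  obtain ⟨B, hB⟩ := (Set.finite_range f).bddAbove
  obtain ⟨N1, hN1, hN1q⟩ := hq (max (N + 1) B)
  have h1 : N + 1 ≤ N1 := (le_max_left _ _).trans hN1
  have h2 : B ≤ N1 := (le_max_right _ _).trans hN1
  refine ⟨N, N1 - N, by omega, hNq, by rw [Nat.add_sub_cancel' (by omega)]; exact hN1q, ?_⟩
  ext x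
  constructor
  · rintro ⟨j, _, rfl⟩
    exact hN0 _ (by omega)
  · intro hx
    obtain ⟨h3, h4⟩ := hf x hx
    have h5 : f x ≤ B := hB ⟨x, rfl⟩
    exact ⟨f x - N, by omega, by rw [Nat.add_sub_cancel' h3]; exact h4⟩

namespace Transducer

variable (T : Transducer A Q Mem)

theorem run_append (m : Mem) (u v : List A) : T.run m (u ++ v) = T.run (T.run m u) v := by
  simp [run]

theorem pathStates_nil (m : Mem) : T.pathStates m [] = {m} := by
  ext x; simp [pathStates, run, eq_comm]

theorem pathStates_append (m : Mem) (u v : List A) :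
    T.pathStates m (u ++ v) = T.pathStates m u ∪ T.pathStates (T.run m u) v := by
  ext x
  constructor
  · rintro ⟨p, hp, rfl⟩
    rcases List.prefix_or_prefix_of_prefix hp (List.prefix_append u v) with h | ⟨s, rfl⟩
    · exact Or.inl ⟨p, h, rfl⟩
    · exact Or.inr ⟨s, (List.prefix_append_right_inj u).1 hp, (T.run_append _ _ _).symm⟩
  · rintro (⟨p, hp, rfl⟩ | ⟨p, hp, rfl⟩)
    · exact ⟨p, hp.trans (List.prefix_append _ _), rfl⟩
    · exact ⟨u ++ p, (List.prefix_append_right_inj u).2 hp, T.run_append _ _ _⟩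

theorem start_mem (m : Mem) (u : List A) : m ∈ T.pathStates m u :=
  ⟨[], List.nil_prefix, rfl⟩

theorem end_mem (m : Mem) (u : List A) : T.run m u ∈ T.pathStates m u :=
  ⟨u, List.prefix_rfl, rfl⟩

theorem pathStates_single (m : Mem) (a : A) : T.pathStates m [a] = {m, T.upd m a} := by
  ext x
  constructor
  · rintro ⟨p, hp, rfl⟩
    rcases p with _ | ⟨b, p⟩
    · left; rfl
    · obtain ⟨s, hs⟩ := hp
      simp at hs
      obtain ⟨rfl, rfl, _⟩ := hs
      right; rfl
  · rintro (rfl | rfl)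
    · exact T.start_mem _ _
    · exact T.end_mem m [a]

/-- memory run on an infinite word -/
def mrun (w : ℕ → A) (n : ℕ) : Mem := T.run T.m0 (prefixWord w n)

theorem mrun_succ (w : ℕ → A) (n : ℕ) : T.mrun w (n + 1) = T.upd (T.mrun w n) (w n) := by
  simp [mrun, prefixWord_succ, run]

theorem exists_seg (w : ℕ → A) (N k : ℕ) : ∃ u : List A, u.length = k ∧
    T.run (T.mrun w N) u = T.mrun w (N + k) ∧
    T.pathStates (T.mrun w N) u = {x | ∃ j, j ≤ k ∧ T.mrun w (N + j) = x} := by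
  induction k with
  | zero =>
    refine ⟨[], rfl, rfl, ?_⟩
    rw [pathStates_nil]; ext x; simp [eq_comm]
  | succ k ih =>
    obtain ⟨u, h1, h2, h3⟩ := ih
    refine ⟨u ++ [w (N + k)], by simp [h1], ?_, ?_⟩
    · rw [run_append, h2, ← add_assoc, mrun_succ]; rfl
    · rw [pathStates_append, h2, h3, pathStates_single, ← mrun_succ]
      ext x
      constructor
      · rintro (⟨j, hj, rfl⟩ | rfl | rfl)
        · exact ⟨j, by omega, rfl⟩
        · exact ⟨k, by omega, rfl⟩
        · exact ⟨k + 1, le_rfl, rfl⟩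
      · rintro ⟨j, hj, rfl⟩
        rcases Nat.lt_or_ge k j with h | h
        · obtain rfl : j = k + 1 := by omega
          right; right; rfl
        · exact Or.inl ⟨j, h, rfl⟩

theorem exists_limit (m : Mem) (D : Set Mem) (V : ℕ → List A)
    (h0 : T.run T.m0 (V 0) = m)
    (hV : ∀ k, T.run T.m0 (V k) = m →
      ∃ z, V (k + 1) = V k ++ z ∧ z ≠ [] ∧ T.run m z = m ∧ T.pathStates m z = D) :
    ∃ w : ℕ → A, (∀ k, prefixWord w (V k).length = V k) ∧ InfOcc (T.mrun w) = D := by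
  have hm : ∀ k, T.run T.m0 (V k) = m := by
    intro k
    induction k with
    | zero => exact h0
    | succ k ih =>
      obtain ⟨z, h1, _, h2, _⟩ := hV k ih
      rw [h1, run_append, ih, h2]
  replace hV := fun k => hV k (hm k)
  have hmono : ∀ j k, j ≤ k → V j <+: V k := by
    intro j k h
    induction h with
    | refl => exact List.prefix_rfl
    | step _ ih =>
      obtain ⟨z, h1, _⟩ := hV _
      rw [h1]; exact ih.trans (List.prefix_append _ _)
  have hstep : ∀ k, (V k).length < (V (k + 1)).length := by
    intro k
    obtain ⟨z, h1, h2, _⟩ := hV k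
    rw [h1, List.length_append]
    have := List.length_pos_of_ne_nil h2
    omega
  have hlen : ∀ k, k ≤ (V k).length := by
    intro k
    induction k with
    | zero => simp
    | succ k ih => have := hstep k; omega
  let w : ℕ → A := fun i => (V (i + 1))[i]'(hlen (i + 1))
  have hw : ∀ k, prefixWord w (V k).length = V k := by
    intro k
    apply List.ext_getElem
    · simp [length_prefixWord]
    · intro i h1 h2
      simp only [prefixWord, List.getElem_map, List.getElem_range, w]
      rcases le_total (i + 1) k with h | h
      · exact (hmono _ _ h).getElem _
      · exact ((hmono _ _ h).getElem _).symm
  refine ⟨w, hw, ?_⟩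
  ext x
  constructor
  · intro hx
    obtain ⟨n, hn, rfl⟩ := hx (V 0).length
    have : ∃ k, (V k).length ≤ n ∧ n ≤ (V (k + 1)).length := by
      by_contra hc
      push Not at hc
      have : ∀ k, (V k).length ≤ n := by
        intro k
        induction k with
        | zero => exact hn
        | succ k ih => exact (hc k ih).le
      have h1 := this (n + 1)
      have h2 := hlen (n + 1)
      omega
    obtain ⟨k, hk1, hk2⟩ := this
    obtain ⟨z, h1, _, h2, h3⟩ := hV k
    have p1 := prefixWord_mono w hk1
    have p2 := prefixWord_mono w hk2
    rw [hw] at p1 p2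
    obtain ⟨v, hv⟩ := p1
    rw [mrun, ← hv, run_append, hm, ← h3]
    rw [← hv, h1] at p2
    exact ⟨v, (List.prefix_append_right_inj _).1 p2, rfl⟩
  · intro hx n
    obtain ⟨z, h1, _, h2, h3⟩ := hV n
    rw [← h3] at hx
    obtain ⟨v, hv, rfl⟩ := hx
    have p : V n ++ v <+: prefixWord w (V (n + 1)).length := by
      rw [hw, h1]; exact (List.prefix_append_right_inj _).2 hv
    refine ⟨(V n ++ v).length, ?_, ?_⟩
    · have := hlen n
      rw [List.length_append]; omega
    · rw [mrun, ← eq_prefixWord w p, run_append, hm]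

variable {T}

theorem strategyRun_eq (w : ℕ → A) : StrategyRun T.strategy w = fun n => T.out (T.mrun w n) := rfl

theorem mem_lang_iff [Finite Mem] {M : Auto A Q} {acc : Set Q → Prop}
    (hg : IsGFGStrategy M acc T.strategy) (w : ℕ → A) :
    w ∈ M.Lang acc ↔ T.accG acc (InfOcc (T.mrun w)) := by
  have h : T.accG acc (InfOcc (T.mrun w)) ↔ acc (InfOcc (StrategyRun T.strategy w)) := by
    rw [strategyRun_eq, inf_image T.out (T.mrun w), accG]
  rw [h]
  exact ⟨(hg w).2, fun h => ⟨_, (hg w).1, h⟩⟩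

/-- Landweber-style lemma. -/
theorem landweber [Finite Mem] {M : Auto A Q} {acc : Set Q → Prop}
    (hg : IsGFGStrategy M acc T.strategy)
    {Q' : Type} [Finite Q'] {B : Auto A Q'} {β : Set Q'}
    {h : List A → Q'} (hB : IsGFGStrategy B (BuchiAcc β) h)
    (hL : B.Lang (BuchiAcc β) = M.Lang acc)
    {u0 : List A} {m : Mem} (hu0 : T.run T.m0 u0 = m)
    {x y : List A} (hx : T.AccCycle acc m x) (hy : T.CycleThrough m y)
    (hxy : T.pathStates m x ⊆ T.pathStates m y) : T.accG acc (T.pathStates m y) := by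
  have key : ∀ U : List A, ∃ z : List A, T.run T.m0 U = m →
      z ≠ [] ∧ T.run m z = m ∧ T.pathStates m z = T.pathStates m y ∧
      ∃ p, U <+: p ∧ p <+: U ++ z ∧ h p ∈ β := by
    intro U
    by_cases hU : T.run T.m0 U = m
    swap
    · exact ⟨[], fun h => absurd h hU⟩
    let X : ℕ → List A := fun k => (fun l => l ++ x)^[k] []
    have hXs : ∀ k, X (k + 1) = X k ++ x := fun k => Function.iterate_succ_apply' _ _ _
    have hX : ∀ k, T.run m (X k) = m ∧ T.pathStates m (X k) ⊆ T.pathStates m y := by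
      intro k
      induction k with
      | zero =>
        refine ⟨rfl, ?_⟩
        change T.pathStates m [] ⊆ _
        rw [pathStates_nil, Set.singleton_subset_iff]
        exact T.start_mem _ _
      | succ k ih =>
        rw [hXs, run_append, pathStates_append, ih.1]
        exact ⟨hx.1.2, Set.union_subset ih.2 hxy⟩
    obtain ⟨w, hw1, hw2⟩ := T.exists_limit m (T.pathStates m x) (fun k => U ++ X k)
      (by simpa [X] using hU)
      (fun k _ => ⟨x, by simp only [hXs, List.append_assoc], hx.1.1, hx.1.2, rfl⟩)
    have hwL : w ∈ B.Lang (BuchiAcc β) := by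
      rw [hL, mem_lang_iff hg, hw2]; exact hx.2
    obtain ⟨b, hb, hbβ⟩ := (hB w).2 hwL
    obtain ⟨n, hn, hnb⟩ := hb U.length
    have hlen : ∀ k, k ≤ (X k).length := by
      intro k
      induction k with
      | zero => simp
      | succ k ih =>
        rw [hXs, List.length_append]
        have := List.length_pos_of_ne_nil hx.1.1
        omega
    refine ⟨X n ++ y, fun _ => ⟨by simp [hy.1], ?_, ?_, prefixWord w n, ?_, ?_, ?_⟩⟩
    · rw [run_append, (hX n).1, hy.2]
    · rw [pathStates_append, (hX n).1]
      exact Set.union_eq_self_of_subset_left (hX n).2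
    · have h0 := hw1 0
      simp only [X, Function.iterate_zero, id, List.append_nil] at h0
      rw [← h0]
      exact prefixWord_mono w hn
    · have h1 : prefixWord w n <+: U ++ X n := by
        rw [← hw1 n]
        apply prefixWord_mono
        have := hlen n
        rw [List.length_append]; omega
      rw [← List.append_assoc]
      exact h1.trans (List.prefix_append _ _)
    · change StrategyRun h w n ∈ β
      rw [hnb]; exact hbβ
  choose f hf using key
  let V : ℕ → List A := fun k => (fun U => U ++ f U)^[k] u0
  have hVs : ∀ k, V (k + 1) = V k ++ f (V k) := fun k => Function.iterate_succ_apply' _ _ _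
  have hVm : ∀ k, T.run T.m0 (V k) = m := by
    intro k
    induction k with
    | zero => exact hu0
    | succ k ih => rw [hVs, run_append, ih, (hf _ ih).2.1]
  obtain ⟨w, hw1, hw2⟩ := T.exists_limit m (T.pathStates m y) V hu0
    (fun k hk => ⟨f (V k), hVs k, (hf _ hk).1, (hf _ hk).2.1, (hf _ hk).2.2.1⟩)
  rw [← hw2, ← mem_lang_iff hg, ← hL]
  refine ⟨StrategyRun h w, (hB w).1, ?_⟩
  obtain ⟨q, hq, hqβ⟩ := exists_inf (StrategyRun h w) (fun q => q ∈ β) (by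
    intro n
    obtain ⟨-, -, -, p, hp1, hp2, hp3⟩ := hf (V n) (hVm n)
    rw [← hVs, ← hw1 (n + 1)] at hp2
    have hlen : ∀ k, k ≤ (V k).length := by
      intro k
      induction k with
      | zero => simp
      | succ k ih =>
        rw [hVs, List.length_append]
        have := List.length_pos_of_ne_nil (hf _ (hVm k)).1
        omega
    refine ⟨p.length, (hlen n).trans hp1.length_le, ?_⟩
    rw [StrategyRun, ← eq_prefixWord w hp2]
    exact hp3)
  exact ⟨q, hq, hqβ⟩

/-- all cycles through `m` are accepting -/
def GoodMem (T : Transducer A Q Mem) (acc : Set Q → Prop) (m : Mem) : Prop :=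
  ∀ u, T.CycleThrough m u → T.accG acc (T.pathStates m u)

theorem exists_good [Finite Mem] {ι : Type} {E F : ι → Set Q} {M : Auto A Q}
    (hg : IsGFGStrategy M (RabinAcc E F) T.strategy)
    {Q' : Type} [Finite Q'] {B : Auto A Q'} {β : Set Q'}
    {h : List A → Q'} (hB : IsGFGStrategy B (BuchiAcc β) h)
    (hL : B.Lang (BuchiAcc β) = M.Lang (RabinAcc E F))
    {w : ℕ → A} (hw : w ∈ M.Lang (RabinAcc E F)) :
    ∃ m ∈ InfOcc (T.mrun w), T.GoodMem (RabinAcc E F) m := by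
  by_contra hc
  push Not at hc
  obtain ⟨m, hm, -⟩ := exists_inf (T.mrun w) (fun _ => True) (fun n => ⟨n, le_rfl, trivial⟩)
  obtain ⟨N, k, hk, hN, hNk, hS⟩ := exists_window _ hm
  obtain ⟨x, hx1, hx2, hx3⟩ := T.exists_seg w N k
  rw [hN, hNk] at hx2
  rw [hN, hS] at hx3
  have hxne : x ≠ [] := by rintro rfl; simp at hx1; omega
  have : ∀ m, ∃ c, m ∈ InfOcc (T.mrun w) → T.RejCycle (RabinAcc E F) m c := by
    intro m
    by_cases hm : m ∈ InfOcc (T.mrun w)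
    · have := hc m hm
      simp only [GoodMem, not_forall] at this
      obtain ⟨c, h1, h2⟩ := this
      exact ⟨c, fun _ => ⟨h1, h2⟩⟩
    · exact ⟨[], fun h => absurd h hm⟩
  choose c hcc using this
  have key : ∀ t : Set Mem, t.Finite → t ⊆ InfOcc (T.mrun w) → ∃ y, T.CycleThrough m y ∧
      T.pathStates m y = InfOcc (T.mrun w) ∪ ⋃ m' ∈ t, T.pathStates m' (c m') := by
    intro t ht
    induction t, ht using Set.Finite.induction_on with
    | empty => intro _; exact ⟨x, ⟨hxne, hx2⟩, by simp [hx3]⟩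
    | @insert a s _ _ ih =>
      intro hs
      obtain ⟨y, hy1, hy2⟩ := ih ((Set.subset_insert _ _).trans hs)
      have ha := hs (Set.mem_insert _ _)
      have ha' := ha
      rw [← hx3] at ha'
      obtain ⟨p, ⟨s', rfl⟩, rfl⟩ := ha'
      have hca := (hcc _ ha).1.2
      rw [run_append] at hx2
      rw [pathStates_append] at hx3
      refine ⟨y ++ (p ++ (c (T.run m p) ++ s')), ⟨by simp [hy1.1], ?_⟩, ?_⟩
      · rw [run_append, hy1.2, run_append, run_append, hca, hx2]
      · rw [pathStates_append, hy1.2, pathStates_append, pathStates_append, hca, hy2,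
          Set.biUnion_insert, ← hx3]
        ext z
        simp only [Set.mem_union]
        tauto
  obtain ⟨y, hy1, hy2⟩ := key _ (Set.toFinite _) subset_rfl
  have hacc : T.accG (RabinAcc E F) (T.pathStates m y) := by
    refine landweber hg hB hL (u0 := prefixWord w N) hN (x := x) ⟨⟨hxne, hx2⟩, ?_⟩ hy1 ?_
    · rw [hx3]; exact (mem_lang_iff hg w).1 hw
    · rw [hx3, hy2]; exact Set.subset_union_left
  rw [hy2, Set.union_eq_self_of_subset_left, accG, Set.image_iUnion₂] at hacc
  · obtain ⟨m', hm', hr⟩ := rabin_iUnion hacc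
    exact (hcc _ hm').2 hr
  · intro m' hm'
    exact Set.mem_biUnion hm' (T.start_mem _ _)

theorem exists_rej_path [Finite Mem] {ι : Type} {E F : ι → Set Q}
    {m m' : Mem} (h1 : ¬ T.Replaceable (RabinAcc E F) m m')
    (h2 : ¬ T.Replaceable (RabinAcc E F) m' m) :
    ∃ u, u ≠ [] ∧ T.run m' u = m ∧ ¬ T.accG (RabinAcc E F) (T.pathStates m' u) := by
  simp only [Replaceable, GoodPathSet, AllCombosAcc, not_or, not_forall] at h1 h2
  obtain ⟨-, C1, ⟨u0, hu0⟩, hC1, hr1⟩ := h1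
  obtain ⟨-, C2, ⟨v0, hv0⟩, hC2, hr2⟩ := h2
  set U := (⋃ u ∈ C1, T.pathStates m' u) ∪ (⋃ u ∈ C2, T.pathStates m u) with hU
  have key : ∀ t : Set Mem, t.Finite → t ⊆ U → ∃ u, u ≠ [] ∧ T.run m' u = m ∧
      t ⊆ T.pathStates m' u ∧ T.pathStates m' u ⊆ U := by
    intro t ht
    induction t, ht using Set.Finite.induction_on with
    | empty =>
      intro _
      exact ⟨u0, (hC1 hu0).1, (hC1 hu0).2, Set.empty_subset _,
        (Set.subset_biUnion_of_mem (u := fun u => T.pathStates m' u) hu0).trans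
          Set.subset_union_left⟩
    | @insert a s _ _ ih =>
      intro hs
      obtain ⟨u, hu1, hu2, hu3, hu4⟩ := ih ((Set.subset_insert _ _).trans hs)
      have aux : ∀ u1 ∈ C1, ∀ v1 ∈ C2, (a ∈ T.pathStates m' u1 ∨ a ∈ T.pathStates m v1) →
          ∃ u, u ≠ [] ∧ T.run m' u = m ∧
          insert a s ⊆ T.pathStates m' u ∧ T.pathStates m' u ⊆ U := by
        intro u1 hu hv1 hv ha
        have e1 := (hC1 hu).2
        have e2 := (hC2 hv).2
        refine ⟨u ++ (hv1 ++ u1), by simp [hu1], ?_, ?_, ?_⟩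
        · rw [run_append, run_append, hu2, e2, e1]
        · rw [pathStates_append, pathStates_append, hu2, e2]
          apply Set.insert_subset
          · simp only [Set.mem_union]; tauto
          · exact hu3.trans Set.subset_union_left
        · rw [pathStates_append, pathStates_append, hu2, e2]
          refine Set.union_subset hu4 (Set.union_subset ?_ ?_)
          · exact (Set.subset_biUnion_of_mem (u := fun u => T.pathStates m u) hv).trans
              Set.subset_union_right
          · exact (Set.subset_biUnion_of_mem (u := fun u => T.pathStates m' u) hu).trans
              Set.subset_union_left
      have ha := hs (Set.mem_insert _ _)
      simp only [hU, Set.mem_union, Set.mem_iUnion] at ha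
      rcases ha with ⟨u1, h, ha⟩ | ⟨v1, h, ha⟩
      · exact aux u1 h v0 hv0 (Or.inl ha)
      · exact aux u0 hu0 v1 h (Or.inr ha)
  obtain ⟨u, h1, h2, h3, h4⟩ := key U (Set.toFinite _) subset_rfl
  refine ⟨u, h1, h2, ?_⟩
  rw [subset_antisymm h4 h3, hU, accG, Set.image_union]
  intro h
  exact (rabin_union h).elim hr1 hr2

theorem good_unique [Finite Mem] {ι : Type} {E F : ι → Set Q} {M : Auto A Q}
    (ht : TightWrt M (RabinAcc E F) T) {m m' : Mem} (hm : T.GoodMem (RabinAcc E F) m)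
    (ho : T.out m = T.out m') : m' = m := by
  by_contra hne
  obtain ⟨u, hu1, hu2, hu3⟩ := exists_rej_path (ht.2 m m' (Ne.symm hne) ho)
    (ht.2 m' m hne ho.symm)
  obtain ⟨v, hv1, hv2, hv3⟩ := exists_rej_path (ht.2 m' m hne ho.symm)
    (ht.2 m m' (Ne.symm hne) ho)
  have := hm (v ++ u) ⟨by simp [hv1], by rw [run_append, hv2, hu2]⟩
  rw [pathStates_append, hv2, accG, Set.image_union] at this
  exact (rabin_union this).elim hv3 hu3

theorem lift_path [Finite Mem] {ι : Type} {E F : ι → Set Q} {M : Auto A Q}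
    (ht : TightWrt M (RabinAcc E F) T) {w : ℕ → A} {r : ℕ → Q} (hr : M.IsRun w r)
    (N : ℕ) (m : Mem) (hm : T.out m = r N) (k : ℕ) :
    ∃ (u : List A) (Z : Set Q), k ≤ u.length ∧ T.out (T.run m u) = r (N + k) ∧
      T.out '' T.pathStates m u = {x | ∃ j, j ≤ k ∧ r (N + j) = x} ∪ Z ∧
      ¬ RabinAcc E F Z := by
  induction k with
  | zero =>
    refine ⟨[], ∅, le_rfl, hm, ?_, ?_⟩
    · rw [pathStates_nil]; ext x; simp [hm, eq_comm]
    · rintro ⟨i, -, x, hx, -⟩; exact hx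
  | succ k ih =>
    obtain ⟨u, Z, h1, h2, h3, h4⟩ := ih
    obtain ⟨s, hs1, hs2⟩ := ht.1 _ _ _ (hr.2 (N + k))
    have hs2' : T.out (T.upd (T.run T.m0 s) (w (N + k))) = r (N + (k + 1)) := by
      rw [← add_assoc, ← hs2, strategy, run_append]; rfl
    change T.out (T.run T.m0 s) = _ at hs1
    generalize T.run T.m0 s = m3 at hs1 hs2'
    have hset : ({x | ∃ j, j ≤ k + 1 ∧ r (N + j) = x} : Set Q) =
        {x | ∃ j, j ≤ k ∧ r (N + j) = x} ∪ {r (N + k), r (N + (k + 1))} := by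
      ext x
      constructor
      · rintro ⟨j, hj, rfl⟩
        rcases Nat.lt_or_ge k j with h | h
        · obtain rfl : j = k + 1 := by omega
          right; right; rfl
        · exact Or.inl ⟨j, h, rfl⟩
      · rintro (⟨j, hj, rfl⟩ | rfl | rfl)
        · exact ⟨j, by omega, rfl⟩
        · exact ⟨k, by omega, rfl⟩
        · exact ⟨k + 1, le_rfl, rfl⟩
    by_cases he : T.run m u = m3
    · refine ⟨u ++ [w (N + k)], Z, by simpa using h1, ?_, ?_, h4⟩
      · rw [run_append, he]; exact hs2'
      · rw [pathStates_append, he, pathStates_single, Set.image_union, h3, Set.image_pair,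
          hs1, hs2', hset]
        exact Set.union_right_comm _ _ _
    · have ho : T.out (T.run m u) = T.out m3 := by rw [h2, hs1]
      obtain ⟨v, hv1, hv2, hv3⟩ := exists_rej_path (ht.2 _ _ (Ne.symm he) ho.symm)
        (ht.2 _ _ he ho)
      refine ⟨u ++ (v ++ [w (N + k)]), Z ∪ T.out '' T.pathStates (T.run m u) v,
        by simp; omega, ?_, ?_, ?_⟩
      · rw [run_append, run_append, hv2]; exact hs2'
      · rw [pathStates_append, pathStates_append, hv2, pathStates_single, Set.image_union,
          Set.image_union, h3, Set.image_pair, hs1, hs2', hset]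
        ext x
        simp only [Set.mem_union]
        tauto
      · intro h
        exact (rabin_union h).elim h4 hv3

end Transducer

/-- Tight GFG Rabin automata are Büchi-type: a tight GFG Rabin
automaton whose language is GFG-Büchi-realizable has an equivalent GFG Büchi
automaton on the same structure. -/
theorem stmt10 {A Q ι : Type} [Fintype A] [Fintype Q] [Fintype ι]
    (M : Auto A Q) (E F : ι → Set Q)
    (htight : Tight M (RabinAcc E F))
    (hreal : ∃ (Q' : Type) (_ : Fintype Q') (B : Auto A Q') (β : Set Q'),
      IsGFG B (BuchiAcc β) ∧ B.Lang (BuchiAcc β) = M.Lang (RabinAcc E F)) :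
    ∃ α' : Set Q, IsGFG M (BuchiAcc α') ∧
      M.Lang (BuchiAcc α') = M.Lang (RabinAcc E F) := by
  obtain ⟨Mem, _, T, hg, ht⟩ := htight
  obtain ⟨Q', _, B, β, ⟨h, hB⟩, hL⟩ := hreal
  let α' : Set Q := {q | ∃ m, T.out m = q ∧ T.GoodMem (RabinAcc E F) m}
  have hfwd : ∀ w ∈ M.Lang (RabinAcc E F),
      BuchiAcc α' (InfOcc (StrategyRun T.strategy w)) := by
    intro w hw
    obtain ⟨m, hm, hgood⟩ := Transducer.exists_good hg hB hL hw
    refine ⟨T.out m, ?_, m, rfl, hgood⟩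
    rw [Transducer.strategyRun_eq, inf_image T.out (T.mrun w)]
    exact ⟨m, hm, rfl⟩
  have hbwd : ∀ w ∈ M.Lang (BuchiAcc α'), w ∈ M.Lang (RabinAcc E F) := by
    rintro w ⟨r, hr, q, hq, m, hmq, hgood⟩
    refine ⟨r, hr, ?_⟩
    obtain ⟨N, k, hk, hN, hNk, hS⟩ := exists_window r hq
    obtain ⟨u, Z, h1, h2, h3, h4⟩ := Transducer.lift_path ht hr N m (hmq.trans hN.symm) k
    have hmu : T.run m u = m :=
      Transducer.good_unique ht hgood (by rw [h2, hNk, hmq])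
    have hacc := hgood u ⟨by rintro rfl; simp at h1; omega, hmu⟩
    rw [Transducer.accG, h3, hS] at hacc
    exact (rabin_union hacc).resolve_right h4
  refine ⟨α', ⟨T.strategy, fun w => ⟨(hg w).1, fun hw => hfwd w (hbwd w hw)⟩⟩, ?_⟩
  ext w
  exact ⟨hbwd w, fun hw => ⟨_, (hg w).1, hfwd w hw⟩⟩

end GFG
end
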